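/- Let R be a commutative noetherian ring and a an ideal, and let F be a flat R-module of finite projective dimension over R. Then the a-adic completion Λ^a(F) is a flat R̂-module, where R̂ is the a-adic completion of R. -/

import Mathlib

open CategoryTheory CategoryTheory.Limits

/-- `N` has projective dimension at most `n` over `A`: it admits a projective resolution
`0 → P_n → ⋯ → P_0 → N → 0`. -/
def ProjDimLE (A : Type u) [CommRing A] (N : Type u) [AddCommGroup N] [Module A N]
    (n : ℕ) : Prop :=
  ∃ C : ChainComplex (ModuleCat.{u} A) ℕ,
    (∀ i, Projective (C.X i)) ∧ (∀ i, n < i → Subsingleton (C.X i)) ∧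
    (∀ i, i ≠ 0 → IsZero (C.homology i)) ∧
    Nonempty (C.homology 0 ≅ ModuleCat.of A N)

section

universe u

/-- The adic completion of a noetherian ring is noetherian: if `a` is generated by a finite set `s`,
it is a quotient of the ring of power series in the variables `s`. -/
theorem isNoetherianRing_adicCompletion {R : Type*} [CommRing R] [IsNoetherianRing R]
    (a : Ideal R) : IsNoetherianRing (AdicCompletion a R) := by
  obtain ⟨s, hs⟩ := IsNoetherian.noetherian a
  let p : MvPolynomial s R →+* R := (MvPolynomial.aeval (fun x : s ↦ (x : R))).toRingHom
  have hp (r : R) : p (MvPolynomial.C r) = r := by simp [p]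
  let J := MvPolynomial.idealOfVars s R
  have hJ : J.map p = a := by
    simp only [J, MvPolynomial.idealOfVars, Ideal.map_span, ← Set.range_comp]
    rw [← hs]
    congr 1
    ext x
    simp [p]
  have hle (n : ℕ) : J ^ n ≤ (a ^ n).comap p := by
    rw [← Ideal.map_le_iff_le_comap, Ideal.map_pow, hJ]
  let B := AdicCompletion J (MvPolynomial s R)
  let f (n : ℕ) : B →+* R ⧸ a ^ n :=
    (Ideal.quotientMap (a ^ n) p (hle n)).comp (AdicCompletion.evalₐ J n : B →+* _)
  have hf {m n : ℕ} (h : m ≤ n) : (Ideal.Quotient.factorPow a h).comp (f n) = f m := by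
    ext x
    induction x using AdicCompletion.induction_on with
    | _ x =>
      have hk (k : ℕ) : f k (AdicCompletion.mk J _ x) = Ideal.Quotient.mk _ (p (x.val k)) := by
        simp only [f, RingHom.comp_apply]
        erw [AdicCompletion.evalₐ_mk, Ideal.quotientMap_mk]
      rw [RingHom.comp_apply, hk, hk]
      simpa using congrArg (Ideal.quotientMap (a ^ m) p (hle m))
        (AdicCompletion.Ideal.mk_eq_mk J h x)
  let φ : B →+* AdicCompletion a R := AdicCompletion.liftRingHom a f hf
  have hφ (b : MvPolynomial s R) : φ (algebraMap _ B b) = algebraMap R _ (p b) := by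
    apply AdicCompletion.ext_evalₐ
    intro n
    simp [φ, f]
  have hmap : (J.map (algebraMap _ B)).map φ = a.map (algebraMap R _) := by
    have : φ.comp (algebraMap _ B) = (algebraMap R (AdicCompletion a R)).comp p :=
      RingHom.ext hφ
    rw [Ideal.map_map, this, ← Ideal.map_map, hJ]
  have hJfg : J.FG := MvPolynomial.idealOfVars_fg s R
  have hafg : a.FG := IsNoetherian.noetherian a
  have : IsAdicComplete J B := AdicCompletion.isAdicComplete hJfg
  have : IsAdicComplete (J.map (algebraMap _ B)) B :=
    (IsAdicComplete.map_algebraMap_iff _ _).mpr this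
  have : IsAdicComplete a (AdicCompletion a R) := AdicCompletion.isAdicComplete hafg
  have : IsAdicComplete ((J.map (algebraMap _ B)).map φ) (AdicCompletion a R) := by
    rw [hmap]
    exact (IsAdicComplete.map_algebraMap_iff _ _).mpr this
  have hsurj : Function.Surjective φ := by
    apply surjective_of_mk_map_comp_surjective (I := J.map (algebraMap _ B))
    intro y
    obtain ⟨y, rfl⟩ := Ideal.Quotient.mk_surjective y
    obtain ⟨r, hr⟩ := Ideal.Quotient.mk_surjective (AdicCompletion.evalOneₐ a y)
    refine ⟨algebraMap (MvPolynomial s R) B (MvPolynomial.C r), ?_⟩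
    rw [RingHom.comp_apply, hφ, hp, Ideal.Quotient.eq, hmap,
      ← AdicCompletion.ker_evalOneₐ_eq_map _ hafg]
    simp [RingHom.mem_ker, ← hr]
  have : IsNoetherianRing B :=
    isNoetherianRing_of_ringEquiv (MvPowerSeries s R)
      (MvPowerSeries.toAdicCompletionAlgEquiv s R).toRingEquiv
  exact isNoetherianRing_of_surjective _ _ φ hsurj

section TensorInjOnTorsion

open TensorProduct

variable {A : Type u} [CommRing A] {I : Ideal A}
  {L : Type u} [AddCommGroup L] [Module A L]

/-- Tensoring with `L` preserves injectivity of maps between modules killed by a power of `I`. -/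
def TensorInjOnTorsion (I : Ideal A) (L : Type u) [AddCommGroup L] [Module A L] : Prop :=
  ∀ (k : ℕ) ⦃P Q : Type u⦄ [AddCommGroup P] [Module A P] [AddCommGroup Q] [Module A Q]
    (f : P →ₗ[A] Q), (∀ r ∈ I ^ k, ∀ x : P, r • x = 0) → (∀ r ∈ I ^ k, ∀ x : Q, r • x = 0) →
    Function.Injective f → Function.Injective (f.lTensor L)

theorem smul_top_le_comap {M N : Type*} [AddCommGroup M] [Module A M] [AddCommGroup N]
    [Module A N] (J : Ideal A) (f : M →ₗ[A] N) :
    (J • ⊤ : Submodule A M) ≤ (J • ⊤ : Submodule A N).comap f := by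
  rw [← Submodule.map_le_iff_le_comap, Submodule.map_smul'']
  exact Submodule.smul_mono le_rfl le_top

/-- An Artin-Rees property for the submodule `K` of `M` after tensoring with `L`. -/
theorem exists_mem_pow_smul_top_of_lTensor [IsNoetherianRing A]
    (hL : TensorInjOnTorsion I L) {M : Type u} [AddCommGroup M] [Module A M] [Module.Finite A M]
    (K : Submodule A M) : ∃ c : ℕ, ∀ k, ∀ z : L ⊗[A] K,
      K.subtype.lTensor L z ∈ (I ^ k • ⊤ : Submodule A (L ⊗[A] M)) →
      z ∈ (I ^ (k - c) • ⊤ : Submodule A (L ⊗[A] K)) := by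
  obtain ⟨c, hc⟩ := I.exists_pow_inf_eq_pow_smul K
  refine ⟨c, fun k z hz ↦ ?_⟩
  rcases lt_or_ge k c with hkc | hkc
  · simp [Nat.sub_eq_zero_of_le hkc.le]
  let U : Submodule A K := (I ^ k • ⊤ : Submodule A M).comap K.subtype
  let f : (K ⧸ U) →ₗ[A] M ⧸ (I ^ k • ⊤ : Submodule A M) := U.mapQ _ K.subtype le_rfl
  have hf : Function.Injective f := by
    rw [← LinearMap.ker_eq_bot]
    exact Submodule.ker_liftQ_eq_bot _ _ _ (by simp [LinearMap.ker_comp, U])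
  have hQ : ∀ r ∈ I ^ k, ∀ x : M ⧸ (I ^ k • ⊤ : Submodule A M), r • x = 0 := by
    intro r hr x
    obtain ⟨x, rfl⟩ := Submodule.mkQ_surjective _ x
    rw [← map_smul, Submodule.mkQ_apply, Submodule.Quotient.mk_eq_zero]
    exact Submodule.smul_mem_smul hr Submodule.mem_top
  have hP : ∀ r ∈ I ^ k, ∀ x : K ⧸ U, r • x = 0 := fun r hr x ↦ hf (by simp [hQ r hr])
  have h0 : U.mkQ.lTensor L z = 0 := by
    apply hL k f hP hQ hf
    rw [← LinearMap.comp_apply, ← LinearMap.lTensor_comp, map_zero]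
    change (((I ^ k • ⊤ : Submodule A M).mkQ ∘ₗ K.subtype).lTensor L) z = 0
    rw [LinearMap.lTensor_comp, LinearMap.comp_apply]
    have h1 := smul_top_le_comap (I ^ k) ((I ^ k • ⊤ : Submodule A M).mkQ.lTensor L) hz
    rw [Submodule.mem_comap] at h1
    refine Submodule.smul_induction_on (p := fun y ↦ y = 0) h1 (fun r hr y _ ↦ ?_)
      (fun x y hx hy ↦ by simp [hx, hy])
    induction y with
    | zero => simp
    | add x y hx hy => simp [hx, hy]
    | tmul l x => rw [← TensorProduct.tmul_smul, hQ r hr, TensorProduct.tmul_zero]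
  obtain ⟨w, rfl⟩ := (lTensor_exact L (LinearMap.exact_subtype_mkQ U) U.mkQ_surjective z).mp h0
  have hU (u : U) : (u : K) ∈ (I ^ (k - c) • ⊤ : Submodule A K) := by
    have h1 : ((u : K) : M) ∈ I ^ (k - c) • K :=
      Submodule.smul_mono le_rfl inf_le_right ((hc k hkc).le ⟨u.2, (u : K).2⟩)
    have h2 : I ^ (k - c) • K = Submodule.map K.subtype (I ^ (k - c) • ⊤) := by
      rw [Submodule.map_smul'', Submodule.map_top, Submodule.range_subtype]
    rw [h2] at h1
    obtain ⟨v, hv, hvu⟩ := h1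
    rwa [← K.injective_subtype hvu]
  clear hz h0
  induction w with
  | zero => simp
  | add x y hx hy => simpa using add_mem hx hy
  | tmul l u => exact smul_top_le_comap (I ^ (k - c)) (TensorProduct.mk A L K l) (hU u)

theorem isPrecomplete_of_surjective {M N : Type u} [AddCommGroup M] [Module A M] [AddCommGroup N]
    [Module A N] [IsPrecomplete I M] (f : M →ₗ[A] N) (hf : Function.Surjective f) :
    IsPrecomplete I N := by
  rw [← AdicCompletion.of_surjective_iff]
  intro y
  obtain ⟨x, rfl⟩ := AdicCompletion.map_surjective I hf y
  obtain ⟨x, rfl⟩ := AdicCompletion.of_surjective I M x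
  exact ⟨f x, (AdicCompletion.map_of I f x).symm⟩

theorem isAdicComplete_pi {M : Type u} [AddCommGroup M] [Module A M] [IsAdicComplete I M] (m : ℕ) :
    IsAdicComplete I (Fin m → M) := by
  rw [← AdicCompletion.of_bijective_iff]
  have h : (AdicCompletion.piEquivOfFintype I (fun _ : Fin m ↦ M)) ∘ AdicCompletion.of I (Fin m → M)
      = fun x i ↦ AdicCompletion.of I M (x i) := by
    ext x i : 2
    simp [AdicCompletion.pi, AdicCompletion.map_of]
  have h2 : Function.Bijective (fun (x : Fin m → M) i ↦ AdicCompletion.of I M (x i)) :=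
    Function.Bijective.piMap fun _ ↦ AdicCompletion.of_bijective_iff.mpr ‹_›
  rw [← h] at h2
  exact (AdicCompletion.piEquivOfFintype I (fun _ : Fin m ↦ M)).bijective.of_comp_iff' _ |>.mp h2

theorem isAdicComplete_congr {M N : Type u} [AddCommGroup M] [Module A M] [AddCommGroup N]
    [Module A N] [IsAdicComplete I M] (e : M ≃ₗ[A] N) : IsAdicComplete I N where
  toIsPrecomplete := isPrecomplete_of_surjective e.toLinearMap e.surjective
  haus' x hx := by
    apply e.symm.injective
    rw [map_zero]
    refine IsHausdorff.haus ‹IsAdicComplete I M›.toIsHausdorff _ fun n ↦ ?_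
    have := hx n
    rw [SModEq.zero] at this ⊢
    exact smul_top_le_comap (I ^ n) e.symm.toLinearMap this

theorem isHausdorff_tensor [IsNoetherianRing A] (hL : TensorInjOnTorsion I L)
    [IsAdicComplete I L] (M : Type u) [AddCommGroup M] [Module A M] [Module.Finite A M] :
    IsHausdorff I (L ⊗[A] M) where
  haus' x hx := by
    have hW (m : ℕ) : IsAdicComplete I (L ⊗[A] (Fin m → A)) :=
      have := isAdicComplete_pi (I := I) (M := L) m
      isAdicComplete_congr (TensorProduct.piScalarRight A A L (Fin m)).symm
    obtain ⟨m, p, hp⟩ := Module.Finite.exists_fin' A M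
    let K := LinearMap.ker p
    obtain ⟨l, q, hq⟩ := Module.Finite.exists_fin' A K
    have : IsAdicComplete I (L ⊗[A] (Fin m → A)) := hW m
    have : IsAdicComplete I (L ⊗[A] (Fin l → A)) := hW l
    have : IsPrecomplete I (L ⊗[A] K) :=
      isPrecomplete_of_surjective (q.lTensor L) (LinearMap.lTensor_surjective L hq)
    obtain ⟨c, hc⟩ := exists_mem_pow_smul_top_of_lTensor hL K
    obtain ⟨w, rfl⟩ := LinearMap.lTensor_surjective L hp x
    have hex : Function.Exact (K.subtype.lTensor L) (p.lTensor L) :=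
      lTensor_exact L p.exact_subtype_ker_map hp
    have hz (k : ℕ) : ∃ z : L ⊗[A] K,
        w - K.subtype.lTensor L z ∈ (I ^ k • ⊤ : Submodule A (L ⊗[A] (Fin m → A))) := by
      have h1 := hx k
      rw [SModEq.zero, ← LinearMap.range_eq_top.mpr (LinearMap.lTensor_surjective L hp),
        LinearMap.range_eq_map, ← Submodule.map_smul''] at h1
      obtain ⟨v, hv, hvw⟩ := h1
      obtain ⟨z, hz⟩ := (hex (w - v)).mp (by simp [hvw])
      exact ⟨z, by simpa [hz] using hv⟩
    choose z hz using hz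
    obtain ⟨y, hy⟩ := IsPrecomplete.prec (I := I) (M := L ⊗[A] K) inferInstance
      (f := fun k ↦ z (k + c)) (fun {i j} hij ↦ by
        rw [SModEq.sub_mem]
        have := hc (i + c) (z (i + c) - z (j + c)) (by
          rw [map_sub]
          have h1 := hz (i + c)
          have h2 := Submodule.smul_mono_left (Ideal.pow_le_pow_right (I := I)
            (Nat.add_le_add_right hij c)) (hz (j + c))
          convert sub_mem h2 h1 using 1
          abel)
        simpa using this)
    have hwy : w = K.subtype.lTensor L y := by
      rw [← sub_eq_zero]
      refine IsHausdorff.haus (I := I) inferInstance _ fun n ↦ ?_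
      rw [SModEq.zero]
      have h1 := Submodule.smul_mono_left (Ideal.pow_le_pow_right (I := I)
            (Nat.le_add_right n c)) (hz (n + c))
      have h2 := smul_top_le_comap (I ^ n) (K.subtype.lTensor L) (SModEq.sub_mem.mp (hy n))
      rw [Submodule.mem_comap, map_sub] at h2
      convert add_mem h1 h2 using 1
      abel
    rw [hwy]
    exact hex.apply_apply_eq_zero y

/-- The local criterion of flatness for adically complete modules over a noetherian ring. -/
theorem flat_of_tensorInjOnTorsion [IsNoetherianRing A] (hL : TensorInjOnTorsion I L)
    [IsAdicComplete I L] : Module.Flat A L := by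
  rw [Module.Flat.iff_lTensor_injective']
  intro J
  rw [injective_iff_map_eq_zero]
  intro t ht
  obtain ⟨c, hc⟩ := exists_mem_pow_smul_top_of_lTensor hL J
  refine IsHausdorff.haus (isHausdorff_tensor hL J) _ fun n ↦ ?_
  rw [SModEq.zero]
  simpa using hc (n + c) t (by rw [ht]; exact zero_mem _)

end TensorInjOnTorsion

section Completion

open TensorProduct

variable {R : Type u} [CommRing R] {a : Ideal R} {k : ℕ}

theorem pow_smul_top_le_ker_mk {F P : Type u} [AddCommGroup F] [Module R F] [AddCommGroup P]
    [Module R P]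
    (hP : ∀ r ∈ a ^ k, ∀ x : P, r • x = 0) :
    (a ^ k • ⊤ : Submodule R F) ≤ LinearMap.ker (TensorProduct.mk R F P) := by
  rw [Submodule.smul_le]
  intro r hr x _
  ext p
  change (r • x) ⊗ₜ[R] p = 0
  rw [TensorProduct.smul_tmul, hP r hr, TensorProduct.tmul_zero]

theorem smul_eq_zero_of_val_eq_zero [IsNoetherianRing R] {P : Type u} [AddCommGroup P] [Module R P]
    [Module (AdicCompletion a R) P] [IsScalarTower R (AdicCompletion a R) P]
    (hP : ∀ r ∈ a ^ k, ∀ x : P, r • x = 0) (α : AdicCompletion a R) (hα : α.val k = 0) (x : P) :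
    α • x = 0 := by
  have h : α ∈ (a ^ k • ⊤ : Submodule R (AdicCompletion a R)) := by
    rw [AdicCompletion.pow_smul_top_eq_ker_eval (IsNoetherian.noetherian a)]
    exact hα
  refine Submodule.smul_induction_on h (fun r hr β _ ↦ ?_) (fun β γ hβ hγ ↦ ?_)
  · rw [smul_assoc, hP r hr]
  · rw [add_smul, hβ, hγ, add_zero]

/-- For `P` killed by `a ^ k`, the canonical map from the tensor product of the completion of `F`
with `P` to `F ⊗[R] P`. -/
noncomputable def completionTensorToTensor [IsNoetherianRing R] (F P : Type u)
    [AddCommGroup F] [Module R F] [AddCommGroup P] [Module R P]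
    [Module (AdicCompletion a R) P] [IsScalarTower R (AdicCompletion a R) P]
    (hP : ∀ r ∈ a ^ k, ∀ x : P, r • x = 0) :
    AdicCompletion a F ⊗[AdicCompletion a R] P →+ F ⊗[R] P :=
  TensorProduct.liftAddHom
    { toFun l := (Submodule.liftQ _ (TensorProduct.mk R F P) (pow_smul_top_le_ker_mk hP)
        (AdicCompletion.eval a F k l)).toAddMonoidHom
      map_zero' := by ext; simp
      map_add' x y := by ext; simp }
    (by
      intro α l p
      obtain ⟨r, hr⟩ := Submodule.mkQ_surjective _ (AdicCompletion.eval a R k α)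
      have h1 : AdicCompletion.eval a F k (α • l) = r • AdicCompletion.eval a F k l := by
        change α.val k • l.val k = _
        change _ = α.val k at hr
        rw [← hr]
        rfl
      have h2 : α • p = r • p := by
        rw [← sub_eq_zero, ← algebraMap_smul (AdicCompletion a R) r p, ← sub_smul]
        apply smul_eq_zero_of_val_eq_zero hP
        change α.val k - _ = 0
        rw [sub_eq_zero]
        exact hr.symm
      change Submodule.liftQ _ (TensorProduct.mk R F P) (pow_smul_top_le_ker_mk hP)
        (AdicCompletion.eval a F k (α • l)) p = Submodule.liftQ _ (TensorProduct.mk R F P)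
          (pow_smul_top_le_ker_mk hP) (AdicCompletion.eval a F k l) (α • p)
      rw [h1, h2, map_smul, map_smul, LinearMap.smul_apply])

theorem completionTensorToTensor_tmul [IsNoetherianRing R] {F P : Type u}
    [AddCommGroup F] [Module R F] [AddCommGroup P] [Module R P]
    [Module (AdicCompletion a R) P] [IsScalarTower R (AdicCompletion a R) P]
    (hP : ∀ r ∈ a ^ k, ∀ x : P, r • x = 0) (l : AdicCompletion a F) (y : F)
    (hy : AdicCompletion.eval a F k l = Submodule.Quotient.mk y) (p : P) :
    completionTensorToTensor F P hP (l ⊗ₜ p) = y ⊗ₜ p := by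
  change Submodule.liftQ _ (TensorProduct.mk R F P) (pow_smul_top_le_ker_mk hP)
    (AdicCompletion.eval a F k l) p = _
  rw [hy, Submodule.liftQ_apply, TensorProduct.mk_apply]

theorem completionTensorToTensor_injective [IsNoetherianRing R] {F P : Type u}
    [AddCommGroup F] [Module R F] [AddCommGroup P] [Module R P]
    [Module (AdicCompletion a R) P] [IsScalarTower R (AdicCompletion a R) P]
    (hP : ∀ r ∈ a ^ k, ∀ x : P, r • x = 0) :
    Function.Injective (completionTensorToTensor F P hP) := by
  let θ : F ⊗[R] P →+ AdicCompletion a F ⊗[AdicCompletion a R] P :=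
    TensorProduct.liftAddHom
      { toFun y := (TensorProduct.mk (AdicCompletion a R) (AdicCompletion a F) P
          (AdicCompletion.of a F y)).toAddMonoidHom
        map_zero' := by ext; simp
        map_add' x y := by ext; simp }
      (by
        intro r y p
        have : AdicCompletion.of a F (r • y) =
            algebraMap R (AdicCompletion a R) r • AdicCompletion.of a F y := by
          rw [algebraMap_smul, map_smul]
        change AdicCompletion.of a F (r • y) ⊗ₜ[AdicCompletion a R] p =
          AdicCompletion.of a F y ⊗ₜ[AdicCompletion a R] (r • p)
        rw [this, TensorProduct.smul_tmul, algebraMap_smul])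
  have hθ (z) : θ (completionTensorToTensor F P hP z) = z := by
    induction z with
    | zero => simp
    | add x y hx hy => simp [hx, hy]
    | tmul l p =>
      obtain ⟨y, hy⟩ := Submodule.Quotient.mk_surjective _ (AdicCompletion.eval a F k l)
      rw [completionTensorToTensor_tmul hP l y hy.symm]
      change AdicCompletion.of a F y ⊗ₜ[AdicCompletion a R] p = _
      rw [← sub_eq_zero, ← TensorProduct.sub_tmul]
      have h : AdicCompletion.of a F y - l ∈ (a ^ k • ⊤ : Submodule R (AdicCompletion a F)) := by
        rw [AdicCompletion.pow_smul_top_eq_ker_eval (IsNoetherian.noetherian a),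
          LinearMap.mem_ker, map_sub, sub_eq_zero, ← hy]
        rfl
      refine Submodule.smul_induction_on (p := fun l ↦ l ⊗ₜ[AdicCompletion a R] p = 0) h
        (fun r hr l _ ↦ ?_) (fun l m hl hm ↦ ?_)
      · rw [← algebraMap_smul (AdicCompletion a R) r l, TensorProduct.smul_tmul, algebraMap_smul,
          hP r hr, TensorProduct.tmul_zero]
      · rw [TensorProduct.add_tmul, hl, hm, add_zero]
  exact Function.LeftInverse.injective hθ

theorem lTensor_adicCompletion_injective [IsNoetherianRing R] (F : Type u) [AddCommGroup F]
    [Module R F] [Module.Flat R F] {P Q : Type u} [AddCommGroup P] [Module (AdicCompletion a R) P]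
    [AddCommGroup Q] [Module (AdicCompletion a R) Q] (f : P →ₗ[AdicCompletion a R] Q)
    (hP : ∀ r ∈ (a.map (algebraMap R (AdicCompletion a R))) ^ k, ∀ x : P, r • x = 0)
    (hQ : ∀ r ∈ (a.map (algebraMap R (AdicCompletion a R))) ^ k, ∀ x : Q, r • x = 0)
    (hf : Function.Injective f) : Function.Injective (f.lTensor (AdicCompletion a F)) := by
  let : Module R P := Module.compHom P (algebraMap R (AdicCompletion a R))
  let : Module R Q := Module.compHom Q (algebraMap R (AdicCompletion a R))
  have : IsScalarTower R (AdicCompletion a R) P := .of_algebraMap_smul fun _ _ ↦ rfl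
  have : IsScalarTower R (AdicCompletion a R) Q := .of_algebraMap_smul fun _ _ ↦ rfl
  have ha {r : R} (hr : r ∈ a ^ k) :
      algebraMap R _ r ∈ (a.map (algebraMap R (AdicCompletion a R))) ^ k := by
    rw [← Ideal.map_pow]
    exact Ideal.mem_map_of_mem _ hr
  have hP' : ∀ r ∈ a ^ k, ∀ x : P, r • x = 0 := fun r hr ↦ hP _ (ha hr)
  have hQ' : ∀ r ∈ a ^ k, ∀ x : Q, r • x = 0 := fun r hr ↦ hQ _ (ha hr)
  have hnat (z) : completionTensorToTensor F Q hQ' (f.lTensor (AdicCompletion a F) z) =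
      (f.restrictScalars R).lTensor F (completionTensorToTensor F P hP' z) := by
    induction z with
    | zero => simp
    | add x y hx hy => simp only [map_add, hx, hy]
    | tmul l p =>
      obtain ⟨y, hy⟩ := Submodule.Quotient.mk_surjective _ (AdicCompletion.eval a F k l)
      rw [LinearMap.lTensor_tmul, completionTensorToTensor_tmul _ l y hy.symm,
        completionTensorToTensor_tmul _ l y hy.symm, LinearMap.lTensor_tmul]
      rfl
  have hinj := (Module.Flat.lTensor_preserves_injective_linearMap (M := F) (f.restrictScalars R)
    hf).comp (completionTensorToTensor_injective (F := F) hP')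
  refine Function.Injective.of_comp (f := completionTensorToTensor F Q hQ') ?_
  convert hinj using 1
  exact funext hnat

end Completion

end

/-- Let `R` be commutative noetherian, `a ⊊ R` an ideal, and `F` a flat
`R`-module of finite projective dimension. Then the `a`-adic completion `Λ^a(F)` is a flat
module over the `a`-adic completion `R̂` of `R`. -/
theorem adicCompletion_flat_over_completion
    {R : Type u} [CommRing R] [IsNoetherianRing R] (a : Ideal R) (ha : a ≠ ⊤)
    (F : Type u) [AddCommGroup F] [Module R F] [Module.Flat R F]
    (hpd : ∃ n : ℕ, ProjDimLE R F n) :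
    Module.Flat (AdicCompletion a R) (AdicCompletion a F) := by
  have hfg : a.FG := IsNoetherian.noetherian a
  have := isNoetherianRing_adicCompletion a
  have : IsAdicComplete a (AdicCompletion a F) := AdicCompletion.isAdicComplete hfg
  have : IsAdicComplete (a.map (algebraMap R (AdicCompletion a R))) (AdicCompletion a F) :=
    (IsAdicComplete.map_algebraMap_iff _ _).mpr this
  exact flat_of_tensorInjOnTorsion (I := a.map (algebraMap R (AdicCompletion a R)))
    fun _ _ _ _ _ _ _ f hP hQ hf ↦ lTensor_adicCompletion_injective F f hP hQ hf
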